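/- arXiv:2003.02107 — 2 statements merged into one kernel-verified Lean document; each statement's English description precedes it below -/
import Mathlib

section
/- Let D be a semicomplete digraph on at least 4 vertices and let r ∈ In(D). Then D has a good r-pair if and only if (D,r) is not an exception, where (D,r) is an exception when r has a unique in-neighbour y in D and y itself has in-degree exactly 1 in D. -/
/-!
Digraphs are modelled by a finite vertex type `V` (with decidable equality) together with
an arc set `A : Finset (V × V)`; irreflexivity (`∀ e ∈ A, e.1 ≠ e.2`) is stated as a
hypothesis.  Subdigraphs on a vertex set `S : Finset V` use arcs with both endpoints in `S`.
-/

variable {V : Type*} [Fintype V] [DecidableEq V]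

/-- Reachability by a directed path using arcs of `B`. -/
def Reach (B : Finset (V × V)) : V → V → Prop :=
  Relation.ReflTransGen (fun u v => (u, v) ∈ B)

/-- `B` is an out-branching, rooted at `q`, of the digraph with vertex set `S`
and arc set `A`: a spanning subdigraph in which every vertex is reachable from `q`
and every vertex other than `q` has in-degree exactly one. -/
def IsOutBranching (S : Finset V) (A B : Finset (V × V)) (q : V) : Prop :=
  q ∈ S ∧ B ⊆ A ∧ (∀ e ∈ B, e.1 ∈ S ∧ e.2 ∈ S) ∧
    (∀ v ∈ S, Reach B q v) ∧
    ∀ v ∈ S, v ≠ q → (B.filter (fun e => e.2 = v)).card = 1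

/-- `B` is an in-branching, rooted at `r`, of the digraph with vertex set `S`
and arc set `A`: a spanning subdigraph in which `r` is reachable from every vertex
and every vertex other than `r` has out-degree exactly one. -/
def IsInBranching (S : Finset V) (A B : Finset (V × V)) (r : V) : Prop :=
  r ∈ S ∧ B ⊆ A ∧ (∀ e ∈ B, e.1 ∈ S ∧ e.2 ∈ S) ∧
    (∀ v ∈ S, Reach B v r) ∧
    ∀ v ∈ S, v ≠ r → (B.filter (fun e => e.1 = v)).card = 1

/-- A good pair: an in-branching and an out-branching sharing no arc. -/
def GoodPair (S : Finset V) (A : Finset (V × V)) : Prop :=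
  ∃ (I O : Finset (V × V)) (r q : V),
    IsInBranching S A I r ∧ IsOutBranching S A O q ∧ Disjoint I O

/-- A good `r`-pair: a good pair whose in-branching is rooted at `r`. -/
def GoodRPair (S : Finset V) (A : Finset (V × V)) (r : V) : Prop :=
  ∃ (I O : Finset (V × V)) (q : V),
    IsInBranching S A I r ∧ IsOutBranching S A O q ∧ Disjoint I O

/-- A good `(r,q)`-pair: in-branching rooted at `r`, out-branching rooted at `q`. -/
def GoodRQPair (S : Finset V) (A : Finset (V × V)) (r q : V) : Prop :=
  ∃ I O : Finset (V × V),
    IsInBranching S A I r ∧ IsOutBranching S A O q ∧ Disjoint I O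

/-- Number of arcs with tail in `X` and head outside `X`. -/
def cutCard (A : Finset (V × V)) (X : Finset V) : ℕ :=
  (A.filter (fun e => e.1 ∈ X ∧ e.2 ∉ X)).card

/-- Arc-connectivity is at least `k`. -/
def ArcConnAtLeast (A : Finset (V × V)) (k : ℕ) : Prop :=
  ∀ X : Finset V, X.Nonempty → X ≠ Finset.univ → k ≤ cutCard A X

/-- Arc-connectivity equals `k`. -/
def ArcConnEq (A : Finset (V × V)) (k : ℕ) : Prop :=
  ArcConnAtLeast A k ∧ ∃ X : Finset V, X.Nonempty ∧ X ≠ Finset.univ ∧ cutCard A X = k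

/-- `S` is an independent set: no two of its vertices are joined by an arc. -/
def IsIndep (A : Finset (V × V)) (S : Finset V) : Prop :=
  ∀ u ∈ S, ∀ v ∈ S, u ≠ v → (u, v) ∉ A ∧ (v, u) ∉ A

/-- The independence number is at most `k`. -/
def IndepNumLE (A : Finset (V × V)) (k : ℕ) : Prop :=
  ∀ S : Finset V, IsIndep A S → S.card ≤ k

/-- The independence number equals `k`. -/
def IndepNumEq (A : Finset (V × V)) (k : ℕ) : Prop :=
  IndepNumLE A k ∧ ∃ S : Finset V, IsIndep A S ∧ S.card = k

/-- The subdigraph induced on `S` is semicomplete. -/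
def SemicompleteOn (S : Finset V) (A : Finset (V × V)) : Prop :=
  ∀ u ∈ S, ∀ v ∈ S, u ≠ v → (u, v) ∈ A ∨ (v, u) ∈ A

/-- The digraph is co-bipartite. -/
def CoBipartite (A : Finset (V × V)) : Prop :=
  ∃ S : Finset V, SemicompleteOn S A ∧ SemicompleteOn Sᶜ A

/-- In-degree of a vertex. -/
def inDeg (A : Finset (V × V)) (v : V) : ℕ := (A.filter (fun e => e.2 = v)).card

/-- Out-degree of a vertex. -/
def outDeg (A : Finset (V × V)) (v : V) : ℕ := (A.filter (fun e => e.1 = v)).card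

/-- Minimum semidegree is at least `k`. -/
def MinSemidegreeGE (A : Finset (V × V)) (k : ℕ) : Prop :=
  ∀ v : V, k ≤ inDeg A v ∧ k ≤ outDeg A v

/-- Reachability by a directed path whose vertices all lie in `T`, using arcs of `A`. -/
def ReachInSet (T : Set V) (A : Finset (V × V)) : V → V → Prop :=
  Relation.ReflTransGen (fun a b => (a, b) ∈ A ∧ a ∈ T ∧ b ∈ T)

/-- `(D, r)` is an exception: `r` has a unique in-neighbour `y`,
and `y` itself has in-degree exactly 1. -/
def IsException {V : Type*} [Fintype V] [DecidableEq V]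
    (A : Finset (V × V)) (r : V) : Prop :=
  ∃ y : V, A.filter (fun e => e.2 = r) = {(y, r)} ∧ inDeg A y = 1

section Branchings

set_option linter.unusedSectionVars false

variable {S : Finset V} {A B : Finset (V × V)} {q r v w : V}

/-- A directed path that enters a set of vertices contains an arc entering it. -/
theorem Reach.exists_entering {u : V} (h : Reach B u v) (T : Finset V) (hu : u ∉ T)
    (hv : v ∈ T) : ∃ x y, (x, y) ∈ B ∧ x ∉ T ∧ y ∈ T := by
  induction h with
  | refl => exact absurd hv hu
  | @tail b c _ hbc ih =>
    by_cases hb : b ∈ T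
    · exact ih hb
    · exact ⟨b, c, hbc, hb, hv⟩

theorem Reach.mono_insert {e : V × V} {u : V} (h : Reach B u v) : Reach (insert e B) u v :=
  Relation.ReflTransGen.mono (fun _ _ => Finset.mem_insert_of_mem) _ _ h

theorem isInBranching_singleton (A : Finset (V × V)) (r : V) : IsInBranching {r} A ∅ r := by
  refine ⟨by simp, by simp, by simp, fun v hv => ?_, by simp⟩
  rw [Finset.mem_singleton.1 hv]
  exact Relation.ReflTransGen.refl

theorem isOutBranching_singleton (A : Finset (V × V)) (q : V) : IsOutBranching {q} A ∅ q := by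
  refine ⟨by simp, by simp, by simp, fun v hv => ?_, by simp⟩
  rw [Finset.mem_singleton.1 hv]
  exact Relation.ReflTransGen.refl

theorem IsInBranching.insert_leaf (h : IsInBranching S A B r) (hv : v ∉ S) (hw : w ∈ S)
    (hvw : (v, w) ∈ A) : IsInBranching (insert v S) A (insert (v, w) B) r := by
  obtain ⟨hr, hBA, hBS, hreach, hdeg⟩ := h
  refine ⟨by simp [hr], Finset.insert_subset hvw hBA, ?_, ?_, ?_⟩
  · intro e he
    rcases Finset.mem_insert.1 he with rfl | he
    · simp [hw]
    · simp [hBS e he]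
  · intro x hx
    rcases Finset.mem_insert.1 hx with rfl | hx
    · exact Relation.ReflTransGen.head (Finset.mem_insert_self _ _) (hreach w hw).mono_insert
    · exact (hreach x hx).mono_insert
  · intro x hx hxr
    rcases Finset.mem_insert.1 hx with rfl | hx
    · have : B.filter (fun e => e.1 = x) = ∅ :=
        Finset.filter_eq_empty_iff.2 fun e he h => hv (h ▸ (hBS e he).1)
      simp [Finset.filter_insert, this]
    · have : v ≠ x := fun h => hv (h ▸ hx)
      simpa [Finset.filter_insert, this] using hdeg x hx hxr

theorem IsOutBranching.insert_leaf (h : IsOutBranching S A B q) (hv : v ∉ S) (hw : w ∈ S)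
    (hwv : (w, v) ∈ A) : IsOutBranching (insert v S) A (insert (w, v) B) q := by
  obtain ⟨hq, hBA, hBS, hreach, hdeg⟩ := h
  refine ⟨by simp [hq], Finset.insert_subset hwv hBA, ?_, ?_, ?_⟩
  · intro e he
    rcases Finset.mem_insert.1 he with rfl | he
    · simp [hw]
    · simp [hBS e he]
  · intro x hx
    rcases Finset.mem_insert.1 hx with rfl | hx
    · exact Relation.ReflTransGen.tail (hreach w hw).mono_insert (Finset.mem_insert_self _ _)
    · exact (hreach x hx).mono_insert
  · intro x hx hxq
    rcases Finset.mem_insert.1 hx with rfl | hx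
    · have : B.filter (fun e => e.2 = x) = ∅ :=
        Finset.filter_eq_empty_iff.2 fun e he h => hv (h ▸ (hBS e he).2)
      simp [Finset.filter_insert, this]
    · have : v ≠ x := fun h => hv (h ▸ hx)
      simpa [Finset.filter_insert, this] using hdeg x hx hxq

theorem IsOutBranching.insert_root (h : IsOutBranching S A B q) (hv : v ∉ S)
    (hvq : (v, q) ∈ A) :
    IsOutBranching (insert v S) A (insert (v, q) (B.filter fun e => e.2 ≠ q)) v := by
  obtain ⟨hq, hBA, hBS, hreach, hdeg⟩ := h
  have hstrip : ∀ x, Reach B q x → Reach (B.filter fun e => e.2 ≠ q) q x := by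
    intro x hx
    induction hx with
    | refl => exact Relation.ReflTransGen.refl
    | @tail b c _ hbc ih =>
      by_cases hc : c = q
      · exact hc ▸ Relation.ReflTransGen.refl
      · exact Relation.ReflTransGen.tail ih (Finset.mem_filter.2 ⟨hbc, hc⟩)
  refine ⟨by simp, Finset.insert_subset hvq ((Finset.filter_subset _ _).trans hBA), ?_, ?_, ?_⟩
  · intro e he
    rcases Finset.mem_insert.1 he with rfl | he
    · simp [hq]
    · simp [hBS e (Finset.mem_filter.1 he).1]
  · intro x hx
    rcases Finset.mem_insert.1 hx with rfl | hx
    · exact Relation.ReflTransGen.refl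
    · exact Relation.ReflTransGen.head (Finset.mem_insert_self _ _)
        (hstrip x (hreach x hx)).mono_insert
  · intro x hx hxv
    have hx := (Finset.mem_insert.1 hx).resolve_left hxv
    by_cases hxq : x = q
    · subst hxq
      have : (B.filter fun e => e.2 ≠ x).filter (fun e => e.2 = x) = ∅ := by
        ext e
        simp
      simp [Finset.filter_insert, this]
    · have : (B.filter fun e => e.2 ≠ q).filter (fun e => e.2 = x) =
          B.filter fun e => e.2 = x := by
        ext e
        simp only [Finset.mem_filter]
        grind
      simpa [Finset.filter_insert, Ne.symm hxq, this] using hdeg x hx hxq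

/-- A good `r`-pair of an induced subdigraph extends to any further vertex that
dominates some vertex of the subdigraph. -/
theorem GoodRPair.insert_vertex (hsc : SemicompleteOn Finset.univ A) (h : GoodRPair S A r)
    (hS : 2 ≤ S.card) (hv : v ∉ S) (hw : w ∈ S) (hvw : (v, w) ∈ A) :
    GoodRPair (insert v S) A r := by
  obtain ⟨I, O, q, hI, hO, hdisj⟩ := h
  have hvI : ∀ x, (x, v) ∉ I ∧ (v, x) ∉ I :=
    fun x => ⟨fun h => hv (hI.2.2.1 _ h).2, fun h => hv (hI.2.2.1 _ h).1⟩
  have hvO : ∀ x, (x, v) ∉ O ∧ (v, x) ∉ O :=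
    fun x => ⟨fun h => hv (hO.2.2.1 _ h).2, fun h => hv (hO.2.2.1 _ h).1⟩
  by_cases hu : ∃ u ∈ S, (u, v) ∈ A
  · obtain ⟨u, huS, huv⟩ := hu
    refine ⟨_, _, q, hI.insert_leaf hv hw hvw, hO.insert_leaf hv huS huv, ?_⟩
    have : v ≠ u := fun h => hv (h ▸ huS)
    simp [hdisj, hvI, hvO, this.symm]
  · push Not at hu
    obtain ⟨x, hx, hxq⟩ := Finset.exists_mem_ne hS q
    have hvS : ∀ y ∈ S, (v, y) ∈ A := fun y hy =>
      (hsc v (Finset.mem_univ _) y (Finset.mem_univ _) fun h => hv (h ▸ hy)).resolve_right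
        (hu y hy)
    refine ⟨_, _, v, hI.insert_leaf hv hx (hvS x hx), hO.insert_root hv (hvS q hO.1), ?_⟩
    have : Disjoint I (O.filter fun e => e.2 ≠ q) :=
      hdisj.mono_right (Finset.filter_subset _ _)
    simp [this, hvI, hvO, hxq.symm]

/-- A good `r`-pair of an induced subdigraph extends to the whole digraph. -/
theorem GoodRPair.univ {S : Finset V} (hsc : SemicompleteOn Finset.univ A)
    (hr : ∀ v, Reach A v r) (h : GoodRPair S A r) (hS : 2 ≤ S.card) :
    GoodRPair Finset.univ A r := by
  by_cases hSu : S = Finset.univ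
  · exact hSu ▸ h
  · obtain ⟨u, hu⟩ : ∃ u, u ∉ S := by
      by_contra! hall
      exact hSu (Finset.eq_univ_iff_forall.2 hall)
    have hrS : r ∈ S := h.choose_spec.choose_spec.choose_spec.1.1
    obtain ⟨v, w, hvw, hv, hw⟩ := (hr u).exists_entering S hu hrS
    have hlt : (insert v S)ᶜ.card < Sᶜ.card :=
      Finset.card_lt_card <| Finset.compl_ssubset_compl.2 (Finset.ssubset_insert hv)
    have hins := h.insert_vertex hsc hS hv hw hvw
    exact GoodRPair.univ hsc hr hins (hS.trans (Finset.card_le_card (Finset.subset_insert _ _)))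
termination_by Sᶜ.card
decreasing_by exact hlt

end Branchings

section FourVertices

variable {A : Finset (V × V)} {r a b c y : V}

/-- A good pair on four vertices built by attaching three leaves to each of the two roots. -/
theorem goodRPair_of_arcs {v₁ v₂ v₃ w₂ w₃ q x₁ x₂ x₃ u₂ u₃ : V}
    (hv : [v₃, v₂, v₁, r].Nodup) (hx : [x₃, x₂, x₁, q].Nodup)
    (hS : ({x₃, x₂, x₁, q} : Finset V) = {v₃, v₂, v₁, r})
    (h₁ : (v₁, r) ∈ A) (h₂ : (v₂, w₂) ∈ A) (h₃ : (v₃, w₃) ∈ A)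
    (k₁ : (q, x₁) ∈ A) (k₂ : (u₂, x₂) ∈ A) (k₃ : (u₃, x₃) ∈ A)
    (hw₂ : w₂ ∈ ({v₁, r} : Finset V)) (hw₃ : w₃ ∈ ({v₂, v₁, r} : Finset V))
    (hu₂ : u₂ ∈ ({x₁, q} : Finset V)) (hu₃ : u₃ ∈ ({x₂, x₁, q} : Finset V))
    (hdisj : Disjoint ({(v₃, w₃), (v₂, w₂), (v₁, r)} : Finset (V × V))
      {(u₃, x₃), (u₂, x₂), (q, x₁)}) :
    GoodRPair {v₃, v₂, v₁, r} A r := by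
  simp only [List.nodup_cons, List.mem_cons, List.not_mem_nil, or_false, not_or] at hv hx
  have hI := (((isInBranching_singleton A r).insert_leaf (v := v₁) (by simp [hv])
    (by simp) h₁).insert_leaf (v := v₂) (by simp [hv]) hw₂ h₂).insert_leaf (v := v₃)
    (by simp [hv]) hw₃ h₃
  have hO := (((isOutBranching_singleton A q).insert_leaf (v := x₁) (by simp [hx])
    (by simp) k₁).insert_leaf (v := x₂) (by simp [hx]) hu₂ k₂).insert_leaf (v := x₃)
    (by simp [hx]) hu₃ k₃
  exact ⟨_, _, q, hI, hS ▸ hO, hdisj⟩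

/-- Four vertices, three of which form a directed path and dominate the root. -/
theorem goodRPair_of_three_inNeighbors_path (hsc : SemicompleteOn Finset.univ A)
    (hd : [a, b, c, r].Nodup) (ha : (a, r) ∈ A) (hb : (b, r) ∈ A) (hc : (c, r) ∈ A)
    (hab : (a, b) ∈ A) (hbc : (b, c) ∈ A) {S : Finset V} (hS : S = {a, b, c, r}) :
    GoodRPair S A r := by
  subst hS
  rcases hsc a (Finset.mem_univ _) c (Finset.mem_univ _) (by grind) with hac | hca
  · exact goodRPair_of_arcs (v₁ := c) (v₂ := b) (v₃ := a) (q := a) (x₁ := b) (x₂ := c)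
      (x₃ := r) hd (by grind) (by grind) hc hb hac hab hbc ha (by simp) (by simp) (by simp)
      (by simp) (by simp; grind)
  · have := goodRPair_of_arcs (v₁ := a) (v₂ := c) (v₃ := b) (q := a) (x₁ := b) (x₂ := c)
      (x₃ := r) (by grind) (by grind) (by grind) ha hca hb hab hbc hc (by simp) (by simp)
      (by simp) (by simp) (by simp; grind)
    rwa [show ({a, b, c, r} : Finset V) = {b, c, a, r} by grind]

theorem goodRPair_of_three_inNeighbors (hsc : SemicompleteOn Finset.univ A)
    (hd : [a, b, c, r].Nodup) (ha : (a, r) ∈ A) (hb : (b, r) ∈ A) (hc : (c, r) ∈ A) :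
    GoodRPair {a, b, c, r} A r := by
  rcases hsc a (Finset.mem_univ _) b (Finset.mem_univ _) (by grind) with hab | hba <;>
  rcases hsc b (Finset.mem_univ _) c (Finset.mem_univ _) (by grind) with hbc | hcb <;>
  rcases hsc a (Finset.mem_univ _) c (Finset.mem_univ _) (by grind) with hac | hca
  · exact goodRPair_of_three_inNeighbors_path hsc (by grind) ha hb hc hab hbc (by grind)
  · exact goodRPair_of_three_inNeighbors_path hsc (by grind) ha hb hc hab hbc (by grind)
  · exact goodRPair_of_three_inNeighbors_path hsc (by grind) ha hc hb hac hcb (by grind)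
  · exact goodRPair_of_three_inNeighbors_path hsc (by grind) hc ha hb hca hab (by grind)
  · exact goodRPair_of_three_inNeighbors_path hsc (by grind) hb ha hc hba hac (by grind)
  · exact goodRPair_of_three_inNeighbors_path hsc (by grind) hb hc ha hbc hca (by grind)
  · exact goodRPair_of_three_inNeighbors_path hsc (by grind) hc hb ha hcb hba (by grind)
  · exact goodRPair_of_three_inNeighbors_path hsc (by grind) hc hb ha hcb hba (by grind)

/-- Four vertices, exactly two of which dominate the root. -/
theorem goodRPair_of_two_inNeighbors (hsc : SemicompleteOn Finset.univ A)
    (hd : [a, b, c, r].Nodup) (ha : (a, r) ∈ A) (hb : (b, r) ∈ A) (hc : (r, c) ∈ A)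
    (hab : (a, b) ∈ A) (hcab : (c, a) ∈ A ∨ (c, b) ∈ A) : GoodRPair {a, b, c, r} A r := by
  by_cases hca : (c, a) ∈ A
  · rcases hsc b (Finset.mem_univ _) c (Finset.mem_univ _) (by grind) with hbc | hcb
    · have := goodRPair_of_arcs (v₁ := a) (v₂ := c) (v₃ := b) (q := a) (x₁ := b) (x₂ := r)
        (x₃ := c) (by grind) (by grind) (by grind) ha hca hbc hab hb hc (by simp) (by simp)
        (by simp) (by simp) (by simp; grind)
      rwa [show ({a, b, c, r} : Finset V) = {b, c, a, r} by grind]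
    · have := goodRPair_of_arcs (v₁ := b) (v₂ := a) (v₃ := c) (q := a) (x₁ := r) (x₂ := c)
        (x₃ := b) (by grind) (by grind) (by grind) hb hab hca ha hc hcb (by simp) (by simp)
        (by simp) (by simp) (by simp; grind)
      rwa [show ({a, b, c, r} : Finset V) = {c, a, b, r} by grind]
  · have hac := (hsc a (Finset.mem_univ _) c (Finset.mem_univ _) (by grind)).resolve_right hca
    have := goodRPair_of_arcs (v₁ := b) (v₂ := c) (v₃ := a) (q := a) (x₁ := b) (x₂ := r)
      (x₃ := c) (by grind) (by grind) (by grind) hb (hcab.resolve_left hca) hac hab ha hc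
      (by simp) (by simp) (by simp) (by simp) (by simp; grind)
    rwa [show ({a, b, c, r} : Finset V) = {a, c, b, r} by grind]

/-- Four vertices with the root dominated by a vertex `y` and dominating the other two,
both of which dominate `y`. -/
theorem goodRPair_of_inNeighbor (hd : [b, c, y, r].Nodup)
    (hyr : (y, r) ∈ A) (hby : (b, y) ∈ A) (hcy : (c, y) ∈ A) (hrb : (r, b) ∈ A)
    (hrc : (r, c) ∈ A) (hbc : (b, c) ∈ A) : GoodRPair {b, c, y, r} A r :=
  goodRPair_of_arcs (q := r) (x₁ := b) (x₂ := y) (x₃ := c) hd (by grind) (by grind)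
    hyr hcy hbc hrb hby hrc (by simp) (by simp) (by simp) (by simp) (by simp; grind)

/-- Four vertices on a path to the root, where the root dominates the other three. -/
theorem goodRPair_of_path (hd : [c, b, y, r].Nodup)
    (hyr : (y, r) ∈ A) (hby : (b, y) ∈ A) (hcb : (c, b) ∈ A) (hry : (r, y) ∈ A)
    (hrb : (r, b) ∈ A) (hrc : (r, c) ∈ A) : GoodRPair {c, b, y, r} A r :=
  goodRPair_of_arcs (q := r) (x₁ := y) (x₂ := b) (x₃ := c) hd hd rfl
    hyr hby hcb hry hrb hrc (by simp) (by simp) (by simp) (by simp) (by simp; grind)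

end FourVertices

section Exception

variable {A : Finset (V × V)} {r : V}

theorem IsException.not_goodRPair (hirr : ∀ e ∈ A, e.1 ≠ e.2)
    (hcard : 3 ≤ Fintype.card V) (h : IsException A r) : ¬ GoodRPair Finset.univ A r := by
  obtain ⟨y, hy, hdeg⟩ := h
  rintro ⟨I, O, q, hI, hO, hdisj⟩
  obtain ⟨e, he⟩ := Finset.card_eq_one.1 hdeg
  have hin_r : ∀ x, (x, r) ∈ A → x = y := fun x hx => by
    have : (x, r) ∈ A.filter (fun e => e.2 = r) := by simp [hx]
    simpa [hy] using this
  have hin_y : ∀ x, (x, y) ∈ A → (x, y) = e := fun x hx => by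
    have : (x, y) ∈ A.filter (fun e => e.2 = y) := by simp [hx]
    simpa [he] using this
  have hyr : y ≠ r := by
    have : (y, r) ∈ A.filter (fun e => e.2 = r) := by simp [hy]
    exact hirr _ (Finset.mem_filter.1 this).1
  have hyrI : (y, r) ∈ I := by
    obtain ⟨x, x', hx, -, hx'⟩ :=
      (hI.2.2.2.1 y (Finset.mem_univ _)).exists_entering {r} (by simp [hyr]) (by simp)
    obtain rfl := Finset.mem_singleton.1 hx'
    exact hin_r x (hI.2.1 hx) ▸ hx
  have heI : e ∈ I := by
    obtain ⟨u, hu⟩ : ∃ u, u ∉ ({y, r} : Finset V) := by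
      by_contra! hall
      have := Finset.card_le_two (a := y) (b := r)
      rw [Finset.eq_univ_iff_forall.2 hall, Finset.card_univ] at this
      omega
    obtain ⟨x, x', hx, hxT, hx'⟩ :=
      (hI.2.2.2.1 u (Finset.mem_univ _)).exists_entering {y, r} hu (by simp)
    rcases Finset.mem_insert.1 hx' with rfl | hx'
    · exact hin_y x (hI.2.1 hx) ▸ hx
    · obtain rfl := Finset.mem_singleton.1 hx'
      exact absurd (hin_r x (hI.2.1 hx)) (by grind)
  have hout : ∀ v, v ≠ q → ∃ x, (x, v) ∈ O := fun v hv => by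
    obtain ⟨x, x', hx, -, hx'⟩ := (hO.2.2.2.1 v (Finset.mem_univ _)).exists_entering {v}
      (by simp [hv.symm]) (by simp)
    exact ⟨x, Finset.mem_singleton.1 hx' ▸ hx⟩
  by_cases hq : r = q
  · obtain ⟨x, hx⟩ := hout y (hq ▸ hyr)
    exact Finset.disjoint_left.1 hdisj heI (hin_y x (hO.2.1 hx) ▸ hx)
  · obtain ⟨x, hx⟩ := hout r hq
    exact Finset.disjoint_left.1 hdisj hyrI (hin_r x (hO.2.1 hx) ▸ hx)

/-- A digraph on at least four vertices that is not an exception contains four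
vertices, including the root, inducing a subdigraph with a good pair. -/
theorem exists_goodRPair_of_not_isException (hirr : ∀ e ∈ A, e.1 ≠ e.2)
    (hcard : 4 ≤ Fintype.card V) (hsc : SemicompleteOn Finset.univ A)
    (hr : ∀ v : V, Reach A v r) (hex : ¬ IsException A r) :
    ∃ S : Finset V, 2 ≤ S.card ∧ GoodRPair S A r := by
  have hirr' : ∀ x, (x, x) ∉ A := fun x hx => hirr _ hx rfl
  have hcard_two : ∀ x y z : V, [x, y, z, r].Nodup → 2 ≤ ({x, y, z, r} : Finset V).card :=
    fun x y z h => Finset.one_lt_card.2 ⟨x, by simp, r, by simp, by grind⟩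
  have henter : ∀ T : Finset V, r ∈ T → T.card ≤ 3 → ∃ x, x ∉ T ∧ ∃ y ∈ T, (x, y) ∈ A := by
    intro T hrT hT
    obtain ⟨u, hu⟩ : ∃ u, u ∉ T := by
      by_contra! hall
      rw [Finset.eq_univ_iff_forall.2 hall, Finset.card_univ] at hT
      omega
    obtain ⟨x, y, hxy, hx, hy⟩ := (hr u).exists_entering T hu hrT
    exact ⟨x, hx, y, hy, hxy⟩
  obtain ⟨a, har, ha⟩ : ∃ a, a ≠ r ∧ (a, r) ∈ A := by
    simpa using henter {r} (by simp) (by simp)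
  by_cases hb : ∃ b, b ≠ a ∧ (b, r) ∈ A
  · obtain ⟨b, hba, hb⟩ := hb
    obtain ⟨c, hcT, x, hxT, hcx⟩ := henter {a, b, r} (by simp) Finset.card_le_three
    have hd : [a, b, c, r].Nodup := by grind
    refine ⟨{a, b, c, r}, hcard_two _ _ _ hd, ?_⟩
    by_cases hcr : (c, r) ∈ A
    · exact goodRPair_of_three_inNeighbors hsc hd ha hb hcr
    · have hrc := (hsc c (Finset.mem_univ _) r (Finset.mem_univ _) (by grind)).resolve_left hcr
      have hcab : (c, a) ∈ A ∨ (c, b) ∈ A := by grind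
      rcases hsc a (Finset.mem_univ _) b (Finset.mem_univ _) hba.symm with hab | hba'
      · exact goodRPair_of_two_inNeighbors hsc hd ha hb hrc hab hcab
      · rw [show ({a, b, c, r} : Finset V) = {b, a, c, r} by grind]
        exact goodRPair_of_two_inNeighbors hsc (by grind) hb ha hrc hba' hcab.symm
  · push Not at hb
    have hout : ∀ x, x ≠ r → x ≠ a → (r, x) ∈ A := fun x hxr hxa =>
      (hsc r (Finset.mem_univ _) x (Finset.mem_univ _) hxr.symm).resolve_right (hb x hxa)
    have two : ∀ b c, b ≠ c → b ≠ r → c ≠ r → (b, a) ∈ A → (c, a) ∈ A →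
        ∃ S : Finset V, 2 ≤ S.card ∧ GoodRPair S A r := by
      intro b c hbc hbr hcr hba hca
      have hba' : b ≠ a := fun h => hirr' a (h ▸ hba)
      have hca' : c ≠ a := fun h => hirr' a (h ▸ hca)
      rcases hsc b (Finset.mem_univ _) c (Finset.mem_univ _) hbc with h | h
      · exact ⟨{b, c, a, r}, hcard_two _ _ _ (by grind), goodRPair_of_inNeighbor (by grind)
          ha hba hca (hout b hbr hba') (hout c hcr hca') h⟩
      · exact ⟨{c, b, a, r}, hcard_two _ _ _ (by grind), goodRPair_of_inNeighbor (by grind)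
          ha hca hba (hout c hcr hca') (hout b hbr hba') h⟩
    obtain ⟨b, hbT, x, hxT, hbx⟩ := henter {a, r} (by simp)
      (Finset.card_le_two.trans (by norm_num))
    have hba : (b, a) ∈ A := by grind
    obtain ⟨c, hcb, hca⟩ : ∃ c, c ≠ b ∧ (c, a) ∈ A := by
      by_contra! hall
      refine hex ⟨a, ?_, Finset.card_eq_one.2 ⟨(b, a), ?_⟩⟩
      · ext ⟨x, z⟩
        grind
      · ext ⟨x, z⟩
        grind
    by_cases hcr : c = r
    · subst hcr
      obtain ⟨d, hdT, x, hxT, hdx⟩ := henter {b, a, c} (by simp) Finset.card_le_three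
      by_cases hda : (d, a) ∈ A
      · exact two b d (by grind) (by grind) (by grind) hba hda
      · have hdb : (d, b) ∈ A := by grind
        exact ⟨{d, b, a, c}, hcard_two _ _ _ (by grind), goodRPair_of_path (by grind)
          ha hba hdb hca (hout b (by grind) (by grind)) (hout d (by grind) (by grind))⟩
    · exact two b c hcb.symm (by grind) hcr hba hca

end Exception

/-- A semicomplete digraph on at least 4 vertices with `r ∈ In(D)`
has a good `r`-pair iff `(D, r)` is not an exception. -/
theorem stmt3 {V : Type*} [Fintype V] [DecidableEq V]
    (A : Finset (V × V)) (hirr : ∀ e ∈ A, e.1 ≠ e.2)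
    (hcard : 4 ≤ Fintype.card V) (hsc : SemicompleteOn Finset.univ A)
    (r : V) (hr : ∀ v : V, Reach A v r) :
    GoodRPair Finset.univ A r ↔ ¬ IsException A r := by
  refine ⟨fun h hex => hex.not_goodRPair hirr (by omega) h, fun hex => ?_⟩
  obtain ⟨S, hS, h⟩ := exists_goodRPair_of_not_isException hirr hcard hsc hr hex
  exact h.univ hsc hr hS
end

section
/- Every digraph D with minimum semidegree δ⁰(D) ≥ 2 and at most 5 vertices has a good pair. -/
/-!
Digraphs are modelled by a finite vertex type `V` (with decidable equality) together with
an arc set `A : Finset (V × V)`; irreflexivity (`∀ e ∈ A, e.1 ≠ e.2`) is stated as a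
hypothesis.  Subdigraphs on a vertex set `S : Finset V` use arcs with both endpoints in `S`.
-/

variable {V : Type*} [Fintype V] [DecidableEq V]

/-- A Hamiltonian path `g 0, …, g (n - 1)` together with an in-branching given by a successor
function `next` that avoids the arcs of the path forms a good pair. -/
theorem goodPair_of_path {V : Type*} [Fintype V] [DecidableEq V] {A : Finset (V × V)}
    {n r : ℕ} {g : ℕ → V} {next : ℕ → ℕ}
    (inj : ∀ i < n, ∀ j < n, g i = g j → i = j) (surj : ∀ v, ∃ i < n, g i = v)
    (hr : r < n) (next_lt : ∀ i < n, next i < n) (iterate_next : ∀ i < n, next^[n] i = r)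
    (next_ne : ∀ i < n, next i ≠ i + 1)
    (path_mem : ∀ i, i + 1 < n → (g i, g (i + 1)) ∈ A)
    (next_mem : ∀ i < n, i ≠ r → (g i, g (next i)) ∈ A) :
    GoodPair Finset.univ A := by
  refine ⟨((Finset.range n).erase r).image fun i => (g i, g (next i)),
    (Finset.range (n - 1)).image fun i => (g i, g (i + 1)), g r, g 0,
    ⟨Finset.mem_univ _, ?_, by simp, ?_, ?_⟩, ⟨Finset.mem_univ _, ?_, by simp, ?_, ?_⟩, ?_⟩
  · intro e he
    obtain ⟨i, hi, rfl⟩ := Finset.mem_image.1 he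
    rw [Finset.mem_erase, Finset.mem_range] at hi
    exact next_mem i hi.2 hi.1
  · have key : ∀ k, ∀ i < n, next^[k] i = r →
        Reach (((Finset.range n).erase r).image fun i => (g i, g (next i))) (g i) (g r) := by
      intro k
      induction k with
      | zero =>
        rintro i - rfl
        exact Relation.ReflTransGen.refl
      | succ k ih =>
        intro i hi h
        by_cases hir : i = r
        · rw [hir]
          exact Relation.ReflTransGen.refl
        · exact Relation.ReflTransGen.head
            (Finset.mem_image_of_mem _ (Finset.mem_erase.2 ⟨hir, Finset.mem_range.2 hi⟩))
            (ih (next i) (next_lt i hi) h)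
    intro v _
    obtain ⟨i, hi, rfl⟩ := surj v
    exact key n i hi (iterate_next i hi)
  · intro v _ hv
    obtain ⟨i, hi, rfl⟩ := surj v
    rw [Finset.card_eq_one]
    refine ⟨(g i, g (next i)), ?_⟩
    ext e
    simp only [Finset.mem_filter, Finset.mem_image, Finset.mem_erase, Finset.mem_range,
      Finset.mem_singleton]
    constructor
    · rintro ⟨⟨j, ⟨-, hj⟩, rfl⟩, h⟩
      rw [inj j hj i hi h]
    · rintro rfl
      exact ⟨⟨i, ⟨fun h => hv (h ▸ rfl), hi⟩, rfl⟩, rfl⟩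
  · intro e he
    obtain ⟨i, hi, rfl⟩ := Finset.mem_image.1 he
    rw [Finset.mem_range] at hi
    exact path_mem i (by omega)
  · have key : ∀ i < n,
        Reach ((Finset.range (n - 1)).image fun i => (g i, g (i + 1))) (g 0) (g i) := by
      intro i
      induction i with
      | zero => exact fun _ => Relation.ReflTransGen.refl
      | succ i ih =>
        exact fun hi => Relation.ReflTransGen.tail (ih (by omega))
          (Finset.mem_image_of_mem _ (Finset.mem_range.2 (by omega)))
    intro v _
    obtain ⟨i, hi, rfl⟩ := surj v
    exact key i hi
  · intro v _ hv
    obtain ⟨i, hi, rfl⟩ := surj v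
    obtain _ | i := i
    · exact absurd rfl hv
    rw [Finset.card_eq_one]
    refine ⟨(g i, g (i + 1)), ?_⟩
    ext e
    simp only [Finset.mem_filter, Finset.mem_image, Finset.mem_range, Finset.mem_singleton]
    constructor
    · rintro ⟨⟨j, hj, rfl⟩, h⟩
      obtain rfl : j = i := Nat.succ_injective (inj (j + 1) (by omega) (i + 1) hi h)
      rfl
    · rintro rfl
      exact ⟨⟨i, by omega, rfl⟩, rfl⟩
  · rw [Finset.disjoint_left]
    intro e he he'
    obtain ⟨i, hi, rfl⟩ := Finset.mem_image.1 he
    obtain ⟨j, hj, h⟩ := Finset.mem_image.1 he'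
    rw [Finset.mem_erase, Finset.mem_range] at hi
    rw [Finset.mem_range] at hj
    rw [Prod.mk.injEq] at h
    obtain rfl : j = i := inj j (by omega) i hi.2 h.1
    exact next_ne j hi.2 (inj _ (by omega) _ (next_lt j hi.2) h.2).symm

/-- The bitmask of a set of arcs on `{0, …, n - 1}`, the arc `(i, j)` being bit `n * i + j`. -/
def arcMask (n : ℕ) (E : List (ℕ × ℕ)) : ℕ :=
  E.foldr (fun e m => Nat.lor (Nat.shiftLeft 1 (n * e.1 + e.2)) m) 0

theorem testBit_shiftLeft_one {i j : ℕ} : (Nat.shiftLeft 1 i).testBit j = true ↔ i = j := by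
  rw [show Nat.shiftLeft 1 i = 2 ^ i from Nat.one_shiftLeft i, Nat.testBit_two_pow,
    decide_eq_true_iff]

theorem testBit_lor {a b i : ℕ} :
    (Nat.lor a b).testBit i = true ↔ a.testBit i = true ∨ b.testBit i = true := by
  rw [show Nat.lor a b = a ||| b from rfl, Nat.testBit_or, Bool.or_eq_true]

theorem testBit_of_land_eq {a b i : ℕ} (h : Nat.land a b = a) (hi : a.testBit i = true) :
    b.testBit i = true := by
  rw [← h, show Nat.land a b = a &&& b from rfl, Nat.testBit_and, Bool.and_eq_true] at hi
  exact hi.2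

theorem testBit_arcMask {n k : ℕ} {E : List (ℕ × ℕ)} :
    (arcMask n E).testBit k = true ↔ ∃ e ∈ E, n * e.1 + e.2 = k := by
  induction E with
  | nil => simp [arcMask]
  | cons e E ih =>
    rw [show arcMask n (e :: E) = Nat.lor (Nat.shiftLeft 1 (n * e.1 + e.2)) (arcMask n E) from rfl,
      testBit_lor, testBit_shiftLeft_one, ih, List.exists_mem_cons_iff]

/-- Decides (by a search of depth at most the first numeral) whether every set of bits which
contains `P`, is disjoint from `N` and meets all masks in the table `T` contains one of the masks
in the list. The entry `T[k]` lists the masks to be checked when bit `k` is excluded. -/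
def covers (T : List (List ℕ)) : ℕ → ℕ → ℕ → List ℕ → Bool
  | 0, _, _, _ => false
  | _ + 1, _, _, [] => false
  | t + 1, P, N, p :: L =>
    match Nat.xor p (Nat.land p P) with
    | 0 => true
    | q + 1 =>
      let k := Nat.log2 (q + 1)
      let b := Nat.shiftLeft 1 k
      ((T.getD k []).any (fun c => Nat.beq (Nat.land c (Nat.lor N b)) c) ||
        covers T t P (Nat.lor N b) ((p :: L).filter fun m => Nat.beq (Nat.land m b) 0)) &&
      covers T t (Nat.lor P b) N (p :: L)

theorem exists_of_covers {T : List (List ℕ)} {S : ℕ → Prop}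
    (hT : ∀ C ∈ T, ∀ c ∈ C, ∃ k, c.testBit k = true ∧ S k) (t P N : ℕ) (L : List ℕ)
    (h : covers T t P N L = true) (hP : ∀ k, P.testBit k = true → S k)
    (hN : ∀ k, N.testBit k = true → ¬ S k) :
    ∃ p ∈ L, ∀ k, p.testBit k = true → S k := by
  induction t generalizing P N L with
  | zero => simp [covers] at h
  | succ t ih =>
    obtain _ | ⟨p, L⟩ := L
    · simp [covers] at h
    rw [covers] at h
    split at h
    · rename_i hp
      refine ⟨p, List.mem_cons_self, fun k hk => hP k (testBit_of_land_eq ?_ hk)⟩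
      exact (Nat.xor_eq_zero_iff.1 hp).symm
    · rename_i q _
      dsimp only at h
      generalize Nat.log2 (q + 1) = k at h
      rw [Bool.and_eq_true, Bool.or_eq_true] at h
      by_cases hk : S k
      · refine ih _ _ _ h.2 (fun i hi => ?_) hN
        rw [testBit_lor, testBit_shiftLeft_one] at hi
        rcases hi with hi | rfl
        exacts [hP i hi, hk]
      · have hN' : ∀ i, (Nat.lor N (Nat.shiftLeft 1 k)).testBit i = true → ¬ S i := by
          intro i hi
          rw [testBit_lor, testBit_shiftLeft_one] at hi
          rcases hi with hi | rfl
          exacts [hN i hi, hk]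
        rcases h.1 with h | h
        · obtain ⟨c, hc, hcN⟩ := List.any_eq_true.1 h
          by_cases hkT : k < T.length
          · rw [List.getD_eq_getElem _ _ hkT] at hc
            obtain ⟨i, hi, hS⟩ := hT _ (List.getElem_mem hkT) c hc
            exact absurd hS (hN' i (testBit_of_land_eq (Nat.eq_of_beq_eq_true hcN) hi))
          · rw [List.getD_eq_default _ _ (not_lt.1 hkT)] at hc
            simp at hc
        · obtain ⟨m, hm, hS⟩ := ih _ _ _ h hP hN'
          exact ⟨m, List.mem_of_mem_filter hm, hS⟩

/-- For distinct `i` and `j`, the arcs from `i` to vertices other than `j`, and the arcs to `i`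
from vertices other than `j`. Both sets are met by every digraph of minimum semidegree two. -/
def semidegreeMasks (n : ℕ) : List ℕ :=
  (List.range n).flatMap fun i => ((List.range n).filter (· ≠ i)).flatMap fun j =>
    let K := (List.range n).filter fun k => k ≠ i ∧ k ≠ j
    [arcMask n (K.map fun k => (i, k)), arcMask n (K.map fun k => (k, i))]

/-- The masks in `semidegreeMasks n`, sorted by the arcs that they contain. -/
def semidegreeTable (n : ℕ) : List (List ℕ) :=
  (List.range (n * n)).map fun k => (semidegreeMasks n).filter fun c => c.testBit k

/-- The path `0, …, n - 1` and the arcs from each vertex other than `r` to its successor. -/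
def patternArcs (n : ℕ) (F : List ℕ × ℕ) : List (ℕ × ℕ) :=
  ((List.range (n - 1)).map fun i => (i, i + 1)) ++
    ((List.range n).filter (· ≠ F.2)).map fun i => (i, F.1.getD i 0)

/-- The successor list `F.1` describes an in-branching rooted at `F.2` which has no arc in common
with the path `0, …, n - 1`. -/
def IsPattern (n : ℕ) (F : List ℕ × ℕ) : Prop :=
  F.2 < n ∧ ∀ i < n, F.1.getD i 0 < n ∧ (fun j => F.1.getD j 0)^[n] i = F.2 ∧
    F.1.getD i 0 ≠ i + 1

instance (n : ℕ) (F : List ℕ × ℕ) : Decidable (IsPattern n F) := by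
  unfold IsPattern
  infer_instance

/-- The masks of all images of the given patterns under permutations of the vertices. -/
def patternMasks (n : ℕ) (Fs : List (List ℕ × ℕ)) : List ℕ :=
  Fs.flatMap fun F => ((List.range n).permutations').map fun s =>
    arcMask n ((patternArcs n F).map fun e => (s.getD e.1 0, s.getD e.2 0))

theorem exists_ne_mem_of_two_le_outDeg {V : Type*} [Fintype V] [DecidableEq V]
    {A : Finset (V × V)} {v : V} (h : 2 ≤ outDeg A v) (w : V) : ∃ u ≠ w, (v, u) ∈ A := by
  obtain ⟨⟨a, u⟩, he, hne⟩ := Finset.exists_mem_ne (Nat.lt_of_succ_le h) (v, w)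
  rw [Finset.mem_filter] at he
  obtain ⟨he, rfl⟩ := he
  exact ⟨u, fun h => hne (h ▸ rfl), he⟩

theorem exists_ne_mem_of_two_le_inDeg {V : Type*} [Fintype V] [DecidableEq V]
    {A : Finset (V × V)} {v : V} (h : 2 ≤ inDeg A v) (w : V) : ∃ u ≠ w, (u, v) ∈ A := by
  obtain ⟨⟨u, a⟩, he, hne⟩ := Finset.exists_mem_ne (Nat.lt_of_succ_le h) (w, v)
  rw [Finset.mem_filter] at he
  obtain ⟨he, rfl⟩ := he
  exact ⟨u, fun h => hne (h ▸ rfl), he⟩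

/-- In a digraph of minimum semidegree two, the vertices can be listed in such a way that the
first one has arcs to the second and to the third. -/
theorem exists_enumeration {V : Type*} [Fintype V] [DecidableEq V] [Nonempty V]
    {A : Finset (V × V)} (hirr : ∀ e ∈ A, e.1 ≠ e.2) (hdeg : MinSemidegreeGE A 2) :
    3 ≤ Fintype.card V ∧ ∃ f : ℕ → V,
      (∀ i < Fintype.card V, ∀ j < Fintype.card V, f i = f j → i = j) ∧
      (∀ v, ∃ i < Fintype.card V, f i = v) ∧ (f 0, f 1) ∈ A ∧ (f 0, f 2) ∈ A := by
  obtain ⟨a⟩ := ‹Nonempty V›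
  obtain ⟨b, hba, hab⟩ := exists_ne_mem_of_two_le_outDeg (hdeg a).2 a
  obtain ⟨c, hcb, hac⟩ := exists_ne_mem_of_two_le_outDeg (hdeg a).2 b
  have hca : c ≠ a := (hirr _ hac).symm
  obtain ⟨l, hl⟩ : ∃ l, l = a :: b :: c :: (Finset.univ \ {a, b, c} : Finset V).toList := ⟨_, rfl⟩
  have hnodup : l.Nodup := by
    simp [hl, Finset.nodup_toList, hba.symm, hca.symm, hcb.symm]
  have hmem : ∀ v, v ∈ l := by
    intro v
    simp only [hl, List.mem_cons, Finset.mem_toList, Finset.mem_sdiff, Finset.mem_univ,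
      Finset.mem_insert, Finset.mem_singleton]
    tauto
  have hlen : l.length = Fintype.card V := by
    rw [← List.toFinset_card_of_nodup hnodup, Finset.card_eq_iff_eq_univ]
    ext v
    simp [hmem v]
  refine ⟨by rw [← hlen, hl]; simp, fun i => l.getD i a, ?_, ?_, by simpa [hl], by simpa [hl]⟩
  · intro i hi j hj h
    rw [← hlen] at hi hj
    simp only [List.getD_eq_getElem _ _ hi, List.getD_eq_getElem _ _ hj] at h
    exact (hnodup.getElem_inj_iff).1 h
  · intro v
    obtain ⟨i, hi, h⟩ := List.getElem_of_mem (hmem v)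
    exact ⟨i, hlen ▸ hi, by simp only [List.getD_eq_getElem _ _ hi, h]⟩

theorem goodPair_of_covers {V : Type*} [Fintype V] [DecidableEq V] [Nonempty V]
    {A : Finset (V × V)} (hirr : ∀ e ∈ A, e.1 ≠ e.2) (hdeg : MinSemidegreeGE A 2)
    {n t : ℕ} {Fs : List (List ℕ × ℕ)} (hn : Fintype.card V = n) (hFs : ∀ F ∈ Fs, IsPattern n F)
    (h : covers (semidegreeTable n) t (arcMask n [(0, 1), (0, 2)]) 0 (patternMasks n Fs) = true) :
    GoodPair Finset.univ A := by
  obtain ⟨hn3, f, inj, surj, h01, h02⟩ := exists_enumeration hirr hdeg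
  rw [hn] at hn3 inj surj
  have hbit : ∀ i j, j < n →
      ((f ((n * i + j) / n), f ((n * i + j) % n)) ∈ A ↔ (f i, f j) ∈ A) := by
    intro i j hj
    rw [Nat.mul_add_div (by omega), Nat.mul_add_mod, Nat.div_eq_of_lt hj, Nat.mod_eq_of_lt hj,
      add_zero]
  have hmasks : ∀ C ∈ semidegreeTable n, ∀ c ∈ C,
      ∃ k, c.testBit k = true ∧ (f (k / n), f (k % n)) ∈ A := by
    intro C hC c hc
    simp only [semidegreeTable, List.mem_map] at hC
    obtain ⟨_, -, rfl⟩ := hC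
    have hc := List.mem_of_mem_filter hc
    simp only [semidegreeMasks, List.mem_flatMap, List.mem_cons, List.not_mem_nil, or_false] at hc
    obtain ⟨i, hi, j, -, hc⟩ := hc
    rw [List.mem_range] at hi
    rcases hc with rfl | rfl
    · obtain ⟨u, hu, he⟩ := exists_ne_mem_of_two_le_outDeg (hdeg (f i)).2 (f j)
      obtain ⟨k, hk, rfl⟩ := surj u
      refine ⟨n * i + k, testBit_arcMask.2 ⟨(i, k), List.mem_map_of_mem ?_, rfl⟩,
        (hbit i k hk).2 he⟩
      have hki : k ≠ i := fun h => hirr _ he (h ▸ rfl)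
      have hkj : k ≠ j := fun h => hu (h ▸ rfl)
      simp [hk, hki, hkj]
    · obtain ⟨u, hu, he⟩ := exists_ne_mem_of_two_le_inDeg (hdeg (f i)).1 (f j)
      obtain ⟨k, hk, rfl⟩ := surj u
      refine ⟨n * k + i, testBit_arcMask.2 ⟨(k, i), List.mem_map_of_mem ?_, rfl⟩,
        (hbit k i hi).2 he⟩
      have hki : k ≠ i := fun h => hirr _ he (h ▸ rfl)
      have hkj : k ≠ j := fun h => hu (h ▸ rfl)
      simp [hk, hki, hkj]
  have hstart : ∀ k, (arcMask n [(0, 1), (0, 2)]).testBit k = true →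
      (f (k / n), f (k % n)) ∈ A := by
    intro k hk
    obtain ⟨e, he, rfl⟩ := testBit_arcMask.1 hk
    simp only [List.mem_cons, List.not_mem_nil, or_false] at he
    rcases he with rfl | rfl
    · exact (hbit 0 1 (by omega)).2 h01
    · exact (hbit 0 2 (by omega)).2 h02
  obtain ⟨p, hp, hS⟩ := exists_of_covers hmasks _ _ _ _ h hstart (by simp)
  simp only [patternMasks, List.mem_flatMap, List.mem_map, List.mem_permutations'] at hp
  obtain ⟨F, hF, s, hs, rfl⟩ := hp
  obtain ⟨hr, hF⟩ := hFs F hF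
  have hlen : s.length = n := by simpa using hs.length_eq
  have hlt : ∀ i < n, s.getD i 0 < n := by
    intro i hi
    rw [List.getD_eq_getElem _ _ (hlen ▸ hi)]
    exact List.mem_range.1 (hs.mem_iff.1 (List.getElem_mem _))
  have hmem : ∀ e ∈ patternArcs n F, e.2 < n → (f (s.getD e.1 0), f (s.getD e.2 0)) ∈ A := by
    intro e he hen
    rw [← hbit _ _ (hlt _ hen)]
    exact hS _ (testBit_arcMask.2 ⟨_, List.mem_map_of_mem he, rfl⟩)
  refine goodPair_of_path (n := n) (r := F.2) (g := fun i => f (s.getD i 0))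
    (next := fun i => F.1.getD i 0) ?_ ?_ hr (fun i hi => (hF i hi).1)
    (fun i hi => (hF i hi).2.1) (fun i hi => (hF i hi).2.2) ?_ ?_
  · intro i hi j hj hij
    have := inj _ (hlt i hi) _ (hlt j hj) hij
    rw [List.getD_eq_getElem _ _ (hlen ▸ hi), List.getD_eq_getElem _ _ (hlen ▸ hj)] at this
    exact ((hs.nodup_iff.2 List.nodup_range).getElem_inj_iff).1 this
  · intro v
    obtain ⟨j, hj, rfl⟩ := surj v
    obtain ⟨i, hi, rfl⟩ := List.getElem_of_mem (hs.mem_iff.2 (List.mem_range.2 hj))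
    exact ⟨i, hlen ▸ hi, by simp only [List.getD_eq_getElem _ _ hi]⟩
  · intro i hi
    refine hmem (i, i + 1) (List.mem_append_left _ ?_) hi
    exact List.mem_map.2 ⟨i, List.mem_range.2 (by omega), rfl⟩
  · intro i hi hir
    refine hmem (i, F.1.getD i 0) (List.mem_append_right _ ?_) (hF i hi).1
    exact List.mem_map.2 ⟨i, List.mem_filter.2 ⟨List.mem_range.2 hi, by simpa using hir⟩, rfl⟩

/-- Every digraph with minimum semidegree at least 2 and at most 5
vertices has a good pair. -/
theorem stmt10 {V : Type*} [Fintype V] [DecidableEq V] [Nonempty V]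
    (A : Finset (V × V)) (hirr : ∀ e ∈ A, e.1 ≠ e.2)
    (hdeg : MinSemidegreeGE A 2) (hcard : Fintype.card V ≤ 5) :
    GoodPair Finset.univ A := by
  have hcard3 : 3 ≤ Fintype.card V := (exists_enumeration hirr hdeg).1
  obtain hn | hn | hn : Fintype.card V = 3 ∨ Fintype.card V = 4 ∨ Fintype.card V = 5 := by omega
  · exact goodPair_of_covers (t := 9) (Fs := [([0, 0, 0], 0)]) hirr hdeg hn
      (by decide +kernel) (by decide +kernel)
  · exact goodPair_of_covers (t := 16) (Fs := [([0, 0, 0, 1], 0), ([0, 0, 1, 0], 0)]) hirr hdeg hn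
      (by decide +kernel) (by decide +kernel)
  · exact goodPair_of_covers (t := 25)
      (Fs := [([4, 0, 0, 3, 3], 3), ([0, 0, 1, 2, 3], 0), ([2, 1, 4, 0, 1], 1),
        ([2, 0, 2, 0, 0], 2)]) hirr hdeg hn (by decide +kernel) (by decide +kernel)
end
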